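/- Let n be a positive integer, let μ ∈ ℝⁿ and σ ∈ ℝⁿ with each σᵢ > 0, and let γⁿ_{μ,σ} denote the product measure on ℝⁿ whose i-th factor is the Gaussian probability measure with mean μᵢ and variance σᵢ². If f : ℝⁿ → ℝ is Lipschitz continuous with respect to the Euclidean norm with Lipschitz constant L (and hence square-integrable with respect to γⁿ_{μ,σ}), then Var(f) ≤ L² · (maxᵢ σᵢ)². -/

import Mathlib

open MeasureTheory ProbabilityTheory

open scoped NNReal ENNReal

lemma gaussianPDFReal_hasDerivAt (m : ℝ) {v : ℝ≥0} (x : ℝ) :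
    HasDerivAt (gaussianPDFReal m v) (-((x - m) / v) * gaussianPDFReal m v x) x := by
  rw [gaussianPDFReal_def]
  have h : HasDerivAt (fun x : ℝ => -(x - m) ^ 2 / (2 * v)) (-((x - m) / v)) x := by
    refine (((((hasDerivAt_id' x).sub_const m).fun_pow 2).fun_neg).div_const
      (2 * (v : ℝ))).congr_deriv ?_
    by_cases hv : (v : ℝ) = 0
    · simp [hv]
    · field_simp
      ring
  exact ((h.exp).const_mul (√(2 * Real.pi * v))⁻¹).congr_deriv (by ring)

lemma integrable_gaussianReal_iff {m : ℝ} {v : ℝ≥0} (hv : v ≠ 0) {f : ℝ → ℝ} :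
    Integrable f (gaussianReal m v) ↔ Integrable (fun x => gaussianPDFReal m v x * f x) := by
  rw [gaussianReal_of_var_ne_zero _ hv, integrable_withDensity_iff_integrable_smul'
    (measurable_gaussianPDF m v) (ae_of_all _ fun _ => ENNReal.ofReal_lt_top)]
  simp only [toReal_gaussianPDF, smul_eq_mul]

lemma LipschitzWith.memLp_of_memLp_id {E : Type*} [NormedAddCommGroup E] [MeasurableSpace E]
    [BorelSpace E] [SecondCountableTopology E]
    {μ : Measure E} [IsFiniteMeasure μ] {p : ℝ≥0∞} (hμ : MemLp id p μ) {K : ℝ≥0} {f : E → ℝ}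
    (hf : LipschitzWith K f) : MemLp f p μ := by
  have h : MemLp (fun x => f x - f 0) p μ := by
    refine hμ.of_le_mul (c := K) (hf.continuous.measurable.sub_const _).aestronglyMeasurable
      (ae_of_all _ fun x => ?_)
    simpa using hf.norm_sub_le x 0
  convert h.add (memLp_const (f 0)) using 1
  ext x
  simp

/-- **Stein's identity** for Lipschitz functions. -/
lemma LipschitzWith.integral_sub_mul_gaussianReal {m : ℝ} {v : ℝ≥0} (hv : v ≠ 0) {K : ℝ≥0}
    {G : ℝ → ℝ} (hG : LipschitzWith K G) :
    ∫ x, (x - m) * G x ∂gaussianReal m v = v * ∫ x, deriv G x ∂gaussianReal m v := by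
  have hv' : (v : ℝ) ≠ 0 := by exact_mod_cast hv
  set p := gaussianPDFReal m v with hp
  have hpd : deriv p = fun x => -((x - m) / v) * p x :=
    funext fun x => (gaussianPDFReal_hasDerivAt m x).deriv
  have hGm : MemLp G 2 (gaussianReal m v) := hG.memLp_of_memLp_id (memLp_id_gaussianReal 2)
  have hid : MemLp (fun x => x - m) 2 (gaussianReal m v) :=
    (memLp_id_gaussianReal (μ := m) (v := v) 2).sub (memLp_const m)
  have i1 : Integrable (fun x => (x - m) * G x) (gaussianReal m v) := hid.integrable_mul hGm
  have i2 : Integrable (deriv G) (gaussianReal m v) :=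
    Integrable.of_bound (measurable_deriv G).aestronglyMeasurable K
      (ae_of_all _ fun x => norm_deriv_le_of_lipschitz hG)
  have i3 : Integrable G (gaussianReal m v) := hGm.integrable (by norm_num)
  rw [integrable_gaussianReal_iff hv] at i1 i2 i3
  have hpac : ∀ a b, AbsolutelyContinuousOnInterval p a b := fun a b => by
    have : ContDiff ℝ 1 p := by
      rw [hp, gaussianPDFReal_def]; fun_prop
    exact this.contDiffOn.absolutelyContinuousOnInterval
  have key : ∀ R : ℝ, ∫ x in (-R)..R, (p x * deriv G x - (p x * ((x - m) * G x)) / v)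
      = p R * G R - p (-R) * G (-R) := fun R => by
    rw [← (hpac (-R) R).integral_deriv_mul_eq_sub
      (hG.lipschitzOnWith.absolutelyContinuousOnInterval)]
    congr 1 with x
    rw [hpd]
    ring
  have hI : Integrable (fun x => p x * deriv G x - (p x * ((x - m) * G x)) / v) :=
    i2.sub (i1.div_const _)
  have hlim := intervalIntegral_tendsto_integral hI Filter.tendsto_neg_atTop_atBot Filter.tendsto_id
  simp only [id, key] at hlim
  have hz := IntegrableAtFilter.eq_zero_of_tendsto (μ := volume)
    ((i3.sub i3.comp_neg).integrableAtFilter _) (fun s hs => by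
      obtain ⟨a, ha⟩ := Filter.mem_atTop_sets.1 hs
      exact measure_mono_top (fun x hx => ha x hx) (Real.volume_Ici (a := a))) hlim
  rw [integral_sub i2 (i1.div_const _), integral_div] at hz
  rw [integral_gaussianReal_eq_integral_smul hv, integral_gaussianReal_eq_integral_smul hv]
  simp only [smul_eq_mul]
  rwa [sub_eq_zero, eq_div_iff hv', mul_comm, eq_comm] at hz

/-- The **Gaussian Poincaré inequality** on `ℝ` for Lipschitz functions. -/
lemma LipschitzWith.variance_gaussianReal_le {m : ℝ} {v : ℝ≥0} (hv : v ≠ 0) {K : ℝ≥0}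
    {g : ℝ → ℝ} (hg : LipschitzWith K g) :
    Var[g; gaussianReal m v] ≤ v * ∫ x, deriv g x ^ 2 ∂gaussianReal m v := by
  have hb : ∀ x, ‖deriv g x ^ 2‖ ≤ (K ^ 2 : ℝ≥0) := fun x => by
    rw [norm_pow]
    push_cast
    gcongr
    exact norm_deriv_le_of_lipschitz hg
  have hii : ∀ a b, IntervalIntegrable (fun x => deriv g x ^ 2) volume a b := fun a b =>
    (intervalIntegrable_const (c := ((K ^ 2 : ℝ≥0) : ℝ))).mono_fun
      ((measurable_deriv g).pow_const 2).aestronglyMeasurable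
      (ae_of_all _ fun x => by simpa using hb x)
  have hi1 : ∀ a b, IntervalIntegrable (deriv g) volume a b := fun a b =>
    (intervalIntegrable_const (c := (K : ℝ))).mono_fun
      (measurable_deriv g).aestronglyMeasurable
      (ae_of_all _ fun x => by simpa using norm_deriv_le_of_lipschitz hg)
  set G : ℝ → ℝ := fun x => ∫ t in m..x, deriv g t ^ 2 with hGdef
  have hG : LipschitzWith (K ^ 2) G := by
    refine LipschitzWith.of_dist_le_mul fun x y => ?_
    rw [Real.dist_eq, Real.dist_eq, hGdef,
      intervalIntegral.integral_interval_sub_left (hii _ _) (hii _ _)]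
    exact intervalIntegral.norm_integral_le_of_norm_le_const fun t _ => hb t
  have hGd : ∀ᵐ x ∂gaussianReal m v, deriv G x = deriv g x ^ 2 := by
    refine (gaussianReal_absolutelyContinuous m hv).ae_le ?_
    have h : ∀ n : ℕ, ∀ᵐ x : ℝ, x ∈ Set.uIcc (m - n) (m + n) → deriv G x = deriv g x ^ 2 := by
      intro n
      filter_upwards [(hii (m - n) (m + n)).ae_hasDerivAt_integral] with x hx hxn
      have hn : (0 : ℝ) ≤ n := n.cast_nonneg
      exact (hx hxn m (Set.mem_uIcc.2 (Or.inl ⟨by linarith, by linarith⟩))).deriv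
    filter_upwards [ae_all_iff.2 h] with x hx
    obtain ⟨n, hn⟩ := exists_nat_ge |x - m|
    have := abs_le.1 hn
    exact hx n (Set.mem_uIcc.2 (Or.inl ⟨by linarith, by linarith⟩))
  have hcs : ∀ x, (g x - g m) ^ 2 ≤ (x - m) * G x := fun x => by
    have e1 : ∫ t in m..x, deriv g t = g x - g m :=
      hg.lipschitzOnWith.absolutelyContinuousOnInterval.integral_deriv_eq_sub
    rcases eq_or_ne x m with rfl | hxm
    · simp
    set c := (g x - g m) / (x - m) with hc
    have e2 : ∫ t in m..x, (deriv g t - c) ^ 2 = G x - (g x - g m) ^ 2 / (x - m) := by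
      have : ∀ t, (deriv g t - c) ^ 2 = deriv g t ^ 2 - 2 * c * deriv g t + c ^ 2 :=
        fun t => by ring
      simp_rw [this]
      rw [intervalIntegral.integral_add ((hii _ _).sub ((hi1 _ _).const_mul _))
        intervalIntegrable_const, intervalIntegral.integral_sub (hii _ _) ((hi1 _ _).const_mul _),
        intervalIntegral.integral_const_mul, intervalIntegral.integral_const, e1, hc, smul_eq_mul]
      have := sub_ne_zero.2 hxm
      field_simp
      ring
    have e3 : 0 ≤ (x - m) * ∫ t in m..x, (deriv g t - c) ^ 2 := by
      rcases le_total m x with h | h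
      · exact mul_nonneg (sub_nonneg.2 h)
          (intervalIntegral.integral_nonneg h fun _ _ => sq_nonneg _)
      · rw [intervalIntegral.integral_symm]
        have := intervalIntegral.integral_nonneg (μ := volume) h
          fun t _ => sq_nonneg (deriv g t - c)
        nlinarith
    rw [e2, mul_sub, mul_div_cancel₀ _ (sub_ne_zero.2 hxm)] at e3
    linarith
  have hgm : AEStronglyMeasurable g (gaussianReal m v) := hg.continuous.aestronglyMeasurable
  have hid : MemLp (fun x => x - m) 2 (gaussianReal m v) :=
    (memLp_id_gaussianReal (μ := m) (v := v) 2).sub (memLp_const m)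
  calc Var[g; gaussianReal m v] = Var[fun x => g x - g m; gaussianReal m v] :=
        (variance_sub_const hgm _).symm
    _ ≤ ∫ x, (g x - g m) ^ 2 ∂gaussianReal m v :=
        variance_le_expectation_sq (hgm.sub aestronglyMeasurable_const)
    _ ≤ ∫ x, (x - m) * G x ∂gaussianReal m v :=
        integral_mono_of_nonneg (ae_of_all _ fun _ => sq_nonneg _)
          (hid.integrable_mul (q := 2) (hG.memLp_of_memLp_id (memLp_id_gaussianReal 2)))
          (ae_of_all _ hcs)
    _ = v * ∫ x, deriv g x ^ 2 ∂gaussianReal m v := by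
        rw [hG.integral_sub_mul_gaussianReal hv, integral_congr_ae hGd]

lemma sq_integral_le_integral_sq {Ω : Type*} [MeasurableSpace Ω] {μ : Measure Ω}
    [IsProbabilityMeasure μ] {X : Ω → ℝ} (hX : MemLp X 2 μ) :
    (∫ x, X x ∂μ) ^ 2 ≤ ∫ x, X x ^ 2 ∂μ := by
  have h := variance_nonneg X μ
  rw [variance_eq_sub hX] at h
  simpa using h

lemma MeasureTheory.MemLp.prod_mk_left_ae {α β : Type*} [MeasurableSpace α] [MeasurableSpace β]
    {μ : Measure α} {ν : Measure β} [SFinite μ] [SFinite ν] {F : α × β → ℝ}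
    (hF : MemLp F 2 (μ.prod ν)) : ∀ᵐ a ∂μ, MemLp (fun b => F (a, b)) 2 ν := by
  filter_upwards [hF.1.prodMk_left, hF.integrable_sq.prod_right_ae] with a h1 h2
  exact (memLp_two_iff_integrable_sq h1).2 h2

lemma MeasureTheory.MemLp.integral_prod_left {α β : Type*} [MeasurableSpace α] [MeasurableSpace β]
    {μ : Measure α} {ν : Measure β} [SFinite μ] [IsProbabilityMeasure ν] {F : α × β → ℝ}
    (hF : MemLp F 2 (μ.prod ν)) : MemLp (fun a => ∫ b, F (a, b) ∂ν) 2 μ := by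
  have hm := hF.1.integral_prod_right'
  refine (memLp_two_iff_integrable_sq hm).2 (hF.integrable_sq.integral_prod_left.mono'
    (hm.pow 2) ?_)
  filter_upwards [hF.prod_mk_left_ae] with a ha
  rw [Real.norm_of_nonneg (sq_nonneg _)]
  exact sq_integral_le_integral_sq ha

lemma integral_variance_prod {α β : Type*} [MeasurableSpace α] [MeasurableSpace β]
    {μ : Measure α} {ν : Measure β} [IsProbabilityMeasure μ] [IsProbabilityMeasure ν]
    {F : α × β → ℝ} (hF : MemLp F 2 (μ.prod ν)) :
    ∫ a, Var[fun b => F (a, b); ν] ∂μ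
      = ∫ z, F z ^ 2 ∂μ.prod ν - ∫ a, (∫ b, F (a, b) ∂ν) ^ 2 ∂μ := by
  rw [integral_prod _ hF.integrable_sq,
    ← integral_sub hF.integrable_sq.integral_prod_left hF.integral_prod_left.integrable_sq]
  refine integral_congr_ae ?_
  filter_upwards [hF.prod_mk_left_ae] with a ha
  rw [variance_eq_sub ha]
  rfl

/-- The **Efron–Stein inequality** for a function of two independent variables. -/
lemma variance_prod_le {α β : Type*} [MeasurableSpace α] [MeasurableSpace β]
    {μ : Measure α} {ν : Measure β} [IsProbabilityMeasure μ] [IsProbabilityMeasure ν]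
    {F : α × β → ℝ} (hF : MemLp F 2 (μ.prod ν)) :
    Var[F; μ.prod ν] ≤
      ∫ b, Var[fun a => F (a, b); μ] ∂ν + ∫ a, Var[fun b => F (a, b); ν] ∂μ := by
  have hF' : MemLp (fun z : β × α => F (z.2, z.1)) 2 (ν.prod μ) :=
    hF.comp_measurePreserving Measure.measurePreserving_swap
  have hFi := hF.integrable one_le_two
  set k : α → ℝ := fun a => ∫ b, F (a, b) ∂ν
  set h : β → ℝ := fun b => ∫ a, F (a, b) ∂μ with hh
  set m : ℝ := ∫ z, F z ∂μ.prod ν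
  have hkL : MemLp k 2 μ := hF.integral_prod_left
  have hhL : MemLp h 2 ν := hF'.integral_prod_left
  have hkm : ∫ a, k a ∂μ = m := (integral_prod F hFi).symm
  have hhm : ∫ b, h b ∂ν = m := (integral_prod_symm F hFi).symm
  have hhp : MemLp (fun z : α × β => h z.2) 2 (μ.prod ν) :=
    hhL.comp_measurePreserving measurePreserving_snd
  have hFh : Integrable (fun z => F z * h z.2) (μ.prod ν) := hF.integrable_mul hhp
  have eFh : ∫ z, F z * h z.2 ∂μ.prod ν = ∫ b, h b ^ 2 ∂ν := by
    rw [integral_prod_symm _ hFh]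
    simp only [integral_mul_const, sq, hh]
  have ehh : ∫ z, h z.2 ^ 2 ∂μ.prod ν = ∫ b, h b ^ 2 ∂ν := by
    rw [integral_fun_snd (fun b => h b ^ 2)]
    simp
  have hD : MemLp (fun z => F z - h z.2) 2 (μ.prod ν) := hF.sub hhp
  have eD : ∫ z, (F z - h z.2) ^ 2 ∂μ.prod ν = ∫ z, F z ^ 2 ∂μ.prod ν - ∫ b, h b ^ 2 ∂ν := by
    have : ∀ z : α × β, (F z - h z.2) ^ 2 = F z ^ 2 - 2 * (F z * h z.2) + h z.2 ^ 2 :=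
      fun z => by ring
    simp_rw [this]
    rw [integral_add (f := fun z => F z ^ 2 - 2 * (F z * h z.2))
        (hF.integrable_sq.sub (hFh.const_mul 2)) hhp.integrable_sq,
      integral_sub hF.integrable_sq (hFh.const_mul 2), integral_const_mul, eFh, ehh]
    ring
  have hvk : ∫ a, k a ^ 2 ∂μ - m ^ 2 ≤ ∫ z, F z ^ 2 ∂μ.prod ν - ∫ b, h b ^ 2 ∂ν := by
    have hv := variance_eq_sub hkL
    rw [variance_eq_integral hkL.aemeasurable, hkm] at hv
    simp only [Pi.pow_apply] at hv
    rw [← hv, ← eD, integral_prod _ hD.integrable_sq]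
    refine integral_mono_ae (hkL.sub (memLp_const m)).integrable_sq
      hD.integrable_sq.integral_prod_left ?_
    filter_upwards [hD.prod_mk_left_ae, hF.prod_mk_left_ae] with a ha haF
    have := sq_integral_le_integral_sq ha
    rwa [integral_sub (haF.integrable one_le_two) (hhL.integrable one_le_two), hhm] at this
  have e1 := integral_variance_prod hF
  have e2 := integral_variance_prod hF'
  have e3 : ∫ z : β × α, F (z.2, z.1) ^ 2 ∂ν.prod μ = ∫ z, F z ^ 2 ∂μ.prod ν :=
    integral_prod_swap (fun z => F z ^ 2)
  simp only [e3] at e2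
  rw [variance_eq_sub hF, e1, e2]
  simp only [Pi.pow_apply]
  linarith

lemma memLp_id_pi_gaussianReal {ι : Type*} [Fintype ι] (m : ι → ℝ) (v : ι → ℝ≥0) :
    MemLp id 2 (Measure.pi fun i => gaussianReal (m i) (v i)) :=
  MemLp.of_eval fun i => (memLp_id_gaussianReal (μ := m i) (v := v i) 2).comp_measurePreserving
    (measurePreserving_eval (fun i => gaussianReal (m i) (v i)) i)

lemma MeasureTheory.Measure.AbsolutelyContinuous.pi_fin {n : ℕ} {α : Fin n → Type*}
    [∀ i, MeasurableSpace (α i)] {μ ν : ∀ i, Measure (α i)} [∀ i, SigmaFinite (μ i)]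
    [∀ i, SigmaFinite (ν i)] (h : ∀ i, μ i ≪ ν i) : Measure.pi μ ≪ Measure.pi ν := by
  induction n with
  | zero => rw [Measure.pi_of_empty, Measure.pi_of_empty]
  | succ n ih =>
    rw [← (measurePreserving_piFinSuccAbove μ 0).symm.map_eq,
      ← (measurePreserving_piFinSuccAbove ν 0).symm.map_eq]
    exact ((h 0).prod (ih fun i => h _)).map (MeasurableEquiv.measurable _)

lemma deriv_fin_cons_eq_lineDeriv {n : ℕ} (f : (Fin (n + 1) → ℝ) → ℝ) (a : ℝ) (b : Fin n → ℝ) :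
    deriv (fun t => f (Fin.cons t b)) a = lineDeriv ℝ f (Fin.cons a b) (Pi.single 0 1) := by
  rw [lineDeriv, ← add_zero a, ← deriv_comp_const_add]
  congr 1 with t
  congr 1 with i
  refine Fin.cases ?_ (fun j => ?_) i <;> simp

lemma lineDeriv_fin_cons_eq_lineDeriv {n : ℕ} (f : (Fin (n + 1) → ℝ) → ℝ) (a : ℝ)
    (b : Fin n → ℝ) (i : Fin n) :
    lineDeriv ℝ (fun x => f (Fin.cons a x)) b (Pi.single i 1)
      = lineDeriv ℝ f (Fin.cons a b) (Pi.single i.succ 1) := by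
  rw [lineDeriv, lineDeriv]
  congr 1 with t
  congr 1 with j
  refine Fin.cases ?_ (fun k => ?_) j <;> simp [Pi.single_apply]

lemma LipschitzWith.integrable_lineDeriv_sq {E : Type*} [NormedAddCommGroup E] [NormedSpace ℝ E]
    [MeasurableSpace E] [BorelSpace E] {μ : Measure E} [IsFiniteMeasure μ] {K : ℝ≥0} {f : E → ℝ}
    (hf : LipschitzWith K f) (w : E) : Integrable (fun x => lineDeriv ℝ f x w ^ 2) μ := by
  refine Integrable.of_bound
    ((measurable_lineDeriv hf.continuous).pow_const 2).aestronglyMeasurable ((K * ‖w‖) ^ 2)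
    (ae_of_all _ fun x => ?_)
  rw [norm_pow]
  gcongr
  exact norm_lineDeriv_le_of_lipschitz ℝ hf

lemma LipschitzWith.fin_cons_left {n : ℕ} {f : (Fin (n + 1) → ℝ) → ℝ} {K : ℝ≥0}
    (hf : LipschitzWith K f) (b : Fin n → ℝ) :
    LipschitzWith K (fun a : ℝ => f (Fin.cons a b)) := by
  have : LipschitzWith 1 (fun a : ℝ => (Fin.cons a b : Fin (n + 1) → ℝ)) :=
    LipschitzWith.mk_one fun x y => (dist_pi_le_iff dist_nonneg).2
      (Fin.cases (by simp) (fun j => by simp))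
  simpa [Function.comp_def] using hf.comp this

lemma LipschitzWith.fin_cons_right {n : ℕ} {f : (Fin (n + 1) → ℝ) → ℝ} {K : ℝ≥0}
    (hf : LipschitzWith K f) (a : ℝ) :
    LipschitzWith K (fun b : Fin n → ℝ => f (Fin.cons a b)) := by
  have : LipschitzWith 1 (fun b : Fin n → ℝ => (Fin.cons a b : Fin (n + 1) → ℝ)) :=
    LipschitzWith.mk_one fun x y => (dist_pi_le_iff dist_nonneg).2
      (Fin.cases (by simp) (fun j => by simpa using dist_le_pi_dist x y j))
  simpa [Function.comp_def] using hf.comp this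

/-- The **Gaussian Poincaré inequality** on `ℝⁿ` for Lipschitz functions. -/
lemma LipschitzWith.variance_pi_gaussianReal_le {n : ℕ} (m : Fin n → ℝ) {v : Fin n → ℝ≥0}
    (hv : ∀ i, v i ≠ 0) {K : ℝ≥0} {f : (Fin n → ℝ) → ℝ} (hf : LipschitzWith K f) :
    Var[f; Measure.pi fun i => gaussianReal (m i) (v i)] ≤
      ∫ x, ∑ i, v i * lineDeriv ℝ f x (Pi.single i 1) ^ 2
        ∂Measure.pi fun i => gaussianReal (m i) (v i) := by
  induction n with
  | zero =>
    have : f = fun _ => f 0 := funext fun x => congrArg f (Subsingleton.elim _ _)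
    rw [this, variance_eq_integral aemeasurable_const]
    simp
  | succ n ih =>
    set γ := Measure.pi fun i => gaussianReal (m i) (v i)
    set γ₀ := gaussianReal (m 0) (v 0)
    set γ' := Measure.pi fun i : Fin n => gaussianReal (m i.succ) (v i.succ)
    have hmp : MeasurePreserving (fun z : ℝ × (Fin n → ℝ) => (Fin.cons z.1 z.2 : Fin (n + 1) → ℝ))
        (γ₀.prod γ') γ := by
      have := (measurePreserving_piFinSuccAbove (fun i => gaussianReal (m i) (v i)) 0).symm
      simpa [MeasurableEquiv.piFinSuccAbove, Fin.insertNthEquiv, Fin.consEquiv] using this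
    have hfL : MemLp f 2 γ := hf.memLp_of_memLp_id (memLp_id_pi_gaussianReal m v)
    have hD : ∀ i, Integrable (fun x => v i * lineDeriv ℝ f x (Pi.single i 1) ^ 2) γ :=
      fun i => (hf.integrable_lineDeriv_sq _).const_mul _
    have hDp : ∀ i, Integrable (fun z : ℝ × (Fin n → ℝ) =>
        v i * lineDeriv ℝ f (Fin.cons z.1 z.2) (Pi.single i 1) ^ 2) (γ₀.prod γ') :=
      fun i => hmp.integrable_comp_of_integrable (hD i)
    have hmap : ∀ i, ∫ x, v i * lineDeriv ℝ f x (Pi.single i 1) ^ 2 ∂γ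
        = ∫ z : ℝ × (Fin n → ℝ),
          v i * lineDeriv ℝ f (Fin.cons z.1 z.2) (Pi.single i 1) ^ 2 ∂γ₀.prod γ' := fun i => by
      rw [← hmp.map_eq, integral_map hmp.aemeasurable (hmp.map_eq ▸ (hD i).1)]
    rw [← hmp.variance_fun_comp hfL.aemeasurable, integral_finsetSum _ fun i _ => hD i,
      Fin.sum_univ_succ]
    refine (variance_prod_le (hfL.comp_measurePreserving hmp)).trans (add_le_add ?_ ?_)
    · rw [hmap, integral_prod_symm _ (hDp 0)]
      refine integral_mono_of_nonneg (ae_of_all _ fun _ => variance_nonneg _ _)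
        (hDp 0).integral_prod_right (ae_of_all _ fun b => ?_)
      refine ((hf.fin_cons_left b).variance_gaussianReal_le (hv 0)).trans_eq ?_
      simp only [deriv_fin_cons_eq_lineDeriv, integral_const_mul]
      rfl
    · simp_rw [hmap]
      rw [← integral_finsetSum _ fun (i : Fin n) _ => hDp i.succ,
        integral_prod _ (integrable_finsetSum _ fun (i : Fin n) _ => hDp i.succ)]
      refine integral_mono_of_nonneg (ae_of_all _ fun _ => variance_nonneg _ _)
        (integrable_finsetSum _ fun (i : Fin n) _ => hDp i.succ).integral_prod_left
        (ae_of_all _ fun a => ?_)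
      refine (ih (fun i => m i.succ) (fun i => hv i.succ) (hf.fin_cons_right a)).trans_eq ?_
      simp only [lineDeriv_fin_cons_eq_lineDeriv]
      rfl

lemma sum_lineDeriv_sq_le {n : ℕ} {f : (Fin n → ℝ) → ℝ} {L : ℝ} (hL : 0 ≤ L)
    (hf : ∀ x y : Fin n → ℝ, |f x - f y| ≤ L * √(∑ i, (x i - y i) ^ 2))
    {x : Fin n → ℝ} (hx : DifferentiableAt ℝ f x) :
    ∑ i, lineDeriv ℝ f x (Pi.single i 1) ^ 2 ≤ L ^ 2 := by
  simp_rw [hx.lineDeriv_eq_fderiv]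
  set w : Fin n → ℝ := fun i => fderiv ℝ f x (Pi.single i 1) with hw
  set s := ∑ i, w i ^ 2 with hs
  have hs0 : 0 ≤ s := Finset.sum_nonneg fun _ _ => sq_nonneg _
  have e : fderiv ℝ f x w = s := by
    conv_lhs => rw [pi_eq_sum_univ' w]
    simp [hs, hw, sq]
  have hlip : LipschitzWith (L * √s).toNNReal (fun t : ℝ => f (x + t • w)) := by
    refine LipschitzWith.of_dist_le_mul fun t u => ?_
    rw [Real.coe_toNNReal _ (by positivity), Real.dist_eq, Real.dist_eq]
    refine (hf _ _).trans_eq ?_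
    have : ∀ i, ((x + t • w) i - (x + u • w) i) ^ 2 = (t - u) ^ 2 * w i ^ 2 := fun i => by
      simp; ring
    simp_rw [this, ← Finset.mul_sum]
    rw [Real.sqrt_mul (sq_nonneg _), Real.sqrt_sq_eq_abs]
    ring
  have h := norm_deriv_le_of_lipschitz (x₀ := 0) hlip
  rw [← lineDeriv, hx.lineDeriv_eq_fderiv, e, Real.coe_toNNReal _ (by positivity),
    Real.norm_of_nonneg hs0] at h
  have hsq := Real.sq_sqrt hs0
  rcases (Real.sqrt_nonneg s).eq_or_lt with h0 | h0
  · rw [← h0] at hsq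
    change s ≤ _
    nlinarith [sq_nonneg L]
  · have : √s ≤ L := by nlinarith
    change s ≤ _
    nlinarith

/-- If `f : ℝⁿ → ℝ` is Lipschitz with constant `L` with respect to the Euclidean norm,
then its variance under the product Gaussian measure `γⁿ_{μ,σ}` (whose `i`-th factor has
mean `μᵢ` and variance `σᵢ²`) satisfies `Var(f) ≤ L²·(maxᵢ σᵢ)²`. -/
theorem multivariate_gaussian_variance_le_lipschitz (n : ℕ) (hn : 0 < n)
    (μ σ : Fin n → ℝ) (hσ : ∀ i, 0 < σ i) (L : ℝ) (hL : 0 ≤ L) (f : (Fin n → ℝ) → ℝ)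
    (hf : ∀ x y : Fin n → ℝ,
      |f x - f y| ≤ L * Real.sqrt (∑ i, (x i - y i) ^ 2)) :
    ∫ x : Fin n → ℝ,
        (f x - ∫ y : Fin n → ℝ, f y
          ∂(Measure.pi fun i => gaussianReal (μ i) ⟨(σ i) ^ 2, sq_nonneg (σ i)⟩)) ^ 2
        ∂(Measure.pi fun i => gaussianReal (μ i) ⟨(σ i) ^ 2, sq_nonneg (σ i)⟩)
      ≤ L ^ 2 * (⨆ i, σ i) ^ 2 := by
  set v : Fin n → ℝ≥0 := fun i => ⟨σ i ^ 2, sq_nonneg (σ i)⟩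
  have hv0 : ∀ i, v i ≠ 0 := fun i h => (pow_pos (hσ i) 2).ne' (congrArg NNReal.toReal h)
  change ∫ x, (f x - ∫ y, f y ∂(Measure.pi fun i => gaussianReal (μ i) (v i))) ^ 2
    ∂(Measure.pi fun i => gaussianReal (μ i) (v i)) ≤ _
  set γ := Measure.pi fun i => gaussianReal (μ i) (v i)
  have hlip : LipschitzWith (L * √n).toNNReal f := by
    refine LipschitzWith.of_dist_le_mul fun x y => ?_
    rw [Real.coe_toNNReal _ (by positivity), Real.dist_eq, mul_assoc]
    refine (hf x y).trans (mul_le_mul_of_nonneg_left ?_ hL)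
    rw [← Real.sqrt_sq (dist_nonneg (x := x) (y := y)), ← Real.sqrt_mul n.cast_nonneg]
    refine Real.sqrt_le_sqrt ((Finset.sum_le_card_nsmul _ _ (dist x y ^ 2) fun i _ => ?_).trans_eq
      (by simp))
    rw [← sq_abs, ← Real.dist_eq]
    exact pow_le_pow_left₀ dist_nonneg (dist_le_pi_dist x y i) 2
  rw [← variance_eq_integral hlip.continuous.measurable.aemeasurable]
  refine (hlip.variance_pi_gaussianReal_le μ hv0).trans ?_
  have hac : γ ≪ volume :=
    Measure.AbsolutelyContinuous.pi_fin fun i => gaussianReal_absolutelyContinuous _ (hv0 i)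
  refine (integral_mono_of_nonneg (ae_of_all _ fun x => Finset.sum_nonneg fun i _ =>
    mul_nonneg (v i).coe_nonneg (sq_nonneg _)) (integrable_const (L ^ 2 * (⨆ i, σ i) ^ 2)) ?_).trans
    (by simp)
  filter_upwards [hac.ae_le hlip.ae_differentiableAt] with x hx
  calc ∑ i, (v i : ℝ) * lineDeriv ℝ f x (Pi.single i 1) ^ 2
      ≤ ∑ i, (⨆ i, σ i) ^ 2 * lineDeriv ℝ f x (Pi.single i 1) ^ 2 := by
        refine Finset.sum_le_sum fun i _ => mul_le_mul_of_nonneg_right ?_ (sq_nonneg _)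
        exact pow_le_pow_left₀ (hσ i).le (le_ciSup (Set.finite_range σ).bddAbove i) 2
    _ = (⨆ i, σ i) ^ 2 * ∑ i, lineDeriv ℝ f x (Pi.single i 1) ^ 2 := (Finset.mul_sum ..).symm
    _ ≤ (⨆ i, σ i) ^ 2 * L ^ 2 :=
        mul_le_mul_of_nonneg_left (sum_lineDeriv_sq_le hL hf hx) (sq_nonneg _)
    _ = L ^ 2 * (⨆ i, σ i) ^ 2 := mul_comm _ _
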